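/- arXiv:1407.1905 — 2 statements merged into one kernel-verified Lean document; each statement's English description precedes it below -/
import Mathlib

section
/- Let a ≥ 2 be an integer and let h, u be odd integers with h ≠ −1, ν₂(u−1) ≥ 2 and ν₂(h−1) = 1. Let h̄ denote the image of h in the quotient group (Z/2^a Z)^*/⟨ū⟩. Then the order of h̄ equals 2^v, where v = max{ min{ν₂(u−1), a} − ν₂(h+1), 1 }. -/
/-- A nonzero integer is its `2`-part times an odd integer. -/
lemma exists_odd_eq_two_pow_padicValInt_mul {z : ℤ} (hz : z ≠ 0) :
    ∃ c : ℤ, Odd c ∧ z = 2 ^ padicValInt 2 z * c := by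
  obtain ⟨c, hc⟩ := (padicValInt_dvd_iff (p := 2) (padicValInt 2 z) z).2 (Or.inr le_rfl)
  push_cast at hc
  refine ⟨c, ?_, hc⟩
  rw [← Int.not_even_iff_odd]
  rintro ⟨d, rfl⟩
  have hdvd : ((2 : ℕ) : ℤ) ^ (padicValInt 2 z + 1) ∣ z := by
    refine ⟨d, ?_⟩
    push_cast
    rw [pow_succ]
    linarith
  rcases (padicValInt_dvd_iff _ _).1 hdvd with h | h
  · exact hz h
  · omega

/-- `2 ^ m` divides `2 ^ n * c` with `c` odd exactly when `m ≤ n`. -/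
lemma two_pow_dvd_two_pow_mul_odd_iff {m n : ℕ} {c : ℤ} (hc : Odd c) :
    (2 : ℤ) ^ m ∣ 2 ^ n * c ↔ m ≤ n := by
  refine ⟨fun h => ?_, fun h => (pow_dvd_pow 2 h).mul_right c⟩
  have hcop : IsCoprime ((2 : ℤ) ^ m) c := (Int.isCoprime_two_left.2 hc).pow_left
  have h' := hcop.dvd_of_dvd_mul_right h
  by_contra! hlt
  have := Int.le_of_dvd (by positivity) h'
  exact absurd this (not_le.2 (pow_lt_pow_right₀ (by norm_num) hlt))

/-- Repeated squaring raises the `2`-adic valuation of `x - 1` by one at each step. -/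
lemma exists_odd_pow_two_pow_sub_one {x c : ℤ} {s : ℕ} (hs : 2 ≤ s) (hc : Odd c)
    (hx : x - 1 = 2 ^ s * c) (j : ℕ) :
    ∃ d : ℤ, Odd d ∧ x ^ 2 ^ j - 1 = 2 ^ (s + j) * d := by
  induction j with
  | zero => exact ⟨c, hc, by simpa using hx⟩
  | succ j ih =>
    obtain ⟨d, hd, h⟩ := ih
    obtain ⟨r, hr⟩ : ∃ r, s + j = r + 2 := ⟨s + j - 2, by omega⟩
    refine ⟨d + 2 * (2 ^ r * d ^ 2), hd.add_even (even_two_mul _), ?_⟩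
    rw [← add_assoc, hr, pow_succ 2 j, pow_mul]
    rw [hr] at h
    rw [sub_eq_iff_eq_add.1 h]
    ring

/-- If `ν₂(u - 1) = s ≥ 2`, the powers of `u` are `2`-adically dense in `1 + 2 ^ s ℤ`. -/
lemma exists_two_pow_dvd_pow_sub {u c t : ℤ} {s : ℕ} (hs : 2 ≤ s) (hc : Odd c)
    (hu : u - 1 = 2 ^ s * c) (ht : (2 : ℤ) ^ s ∣ t - 1) (j : ℕ) :
    ∃ n : ℕ, (2 : ℤ) ^ (s + j) ∣ u ^ n - t := by
  have hodd : Odd u := by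
    rw [sub_eq_iff_eq_add.1 hu]
    exact ((even_two.pow_of_ne_zero (by omega : s ≠ 0)).mul_right c).add_one
  induction j with
  | zero => exact ⟨0, by simpa using dvd_sub_comm.1 ht⟩
  | succ j ih =>
    obtain ⟨n, e, he⟩ := ih
    rcases Int.even_or_odd e with ⟨f, rfl⟩ | hodd_e
    · exact ⟨n, f, by rw [he]; ring⟩
    · obtain ⟨d, hd, h⟩ := exists_odd_pow_two_pow_sub_one hs hc hu j
      obtain ⟨f, hf⟩ := ((hodd.pow (n := n)).mul hd).add_odd hodd_e
      refine ⟨n + 2 ^ j, f, ?_⟩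
      calc u ^ (n + 2 ^ j) - t = u ^ n * (u ^ 2 ^ j - 1) + (u ^ n - t) := by ring
        _ = 2 ^ (s + j) * (u ^ n * d + e) := by rw [h, he]; ring
        _ = 2 ^ (s + (j + 1)) * f := by rw [hf]; ring

/-- The subgroup of `(ℤ/2^a)ˣ` generated by `u ≡ 1 mod 4` consists of the classes congruent to `1`
modulo `2 ^ min (ν₂(u - 1)) a`. -/
lemma mem_zpowers_units_zmod_two_pow_iff {a s : ℕ} {u c t : ℤ} (hs : 2 ≤ s) (hc : Odd c)
    (hu : u - 1 = 2 ^ s * c) {ubar tbar : (ZMod (2 ^ a))ˣ}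
    (hub : (ubar : ZMod (2 ^ a)) = u) (htb : (tbar : ZMod (2 ^ a)) = t) :
    tbar ∈ Subgroup.zpowers ubar ↔ (2 : ℤ) ^ min s a ∣ t - 1 := by
  have key (n : ℕ) : ubar ^ n = tbar ↔ (2 : ℤ) ^ a ∣ u ^ n - t := by
    rw [Units.ext_iff, Units.val_pow_eq_pow_val, hub, htb, dvd_sub_comm]
    have := ZMod.intCast_eq_intCast_iff_dvd_sub (u ^ n) t (2 ^ a)
    push_cast at this
    exact this
  rw [← mem_powers_iff_mem_zpowers, Submonoid.mem_powers_iff]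
  simp only [key]
  constructor
  · rintro ⟨n, hn⟩
    have h1 : (2 : ℤ) ^ min s a ∣ u ^ n - 1 :=
      ((pow_dvd_pow 2 (min_le_left s a)).trans ⟨c, hu⟩).trans (sub_one_dvd_pow_sub_one u n)
    have h2 := (pow_dvd_pow (2 : ℤ) (min_le_right s a)).trans hn
    simpa using dvd_sub h1 h2
  · intro ht
    rcases le_total s a with hsa | has
    · rw [min_eq_left hsa] at ht
      obtain ⟨n, hn⟩ := exists_two_pow_dvd_pow_sub hs hc hu ht (a - s)
      exact ⟨n, by rwa [Nat.add_sub_cancel' hsa] at hn⟩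
    · rw [min_eq_right has] at ht
      exact ⟨0, by simpa using dvd_sub_comm.1 ht⟩


/-- Let `a ≥ 2` and let `h`, `u` be odd integers with `h ≠ -1`,
`ν₂(u-1) ≥ 2` and `ν₂(h-1) = 1`.  Let `hbar`, `ubar` be the residues of `h`, `u`
in `(ZMod (2^a))ˣ`.  Then the order of the image of `hbar` in the quotient group
`(ZMod (2^a))ˣ / ⟨ubar⟩` equals `2 ^ v` where
`v = max (min (ν₂(u-1)) a - ν₂(h+1)) 1`. -/
theorem order_in_quotient_case_iii (a : ℕ) (ha : 2 ≤ a) (h u : ℤ)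
    (hh : Odd h) (hu : Odd u) (hhne : h ≠ -1)
    (hvu : 2 ≤ padicValInt 2 (u - 1)) (hvh : padicValInt 2 (h - 1) = 1)
    (ubar hbar : (ZMod (2 ^ a))ˣ)
    (hub : (ubar : ZMod (2 ^ a)) = (u : ZMod (2 ^ a)))
    (hhb : (hbar : ZMod (2 ^ a)) = (h : ZMod (2 ^ a))) :
    orderOf (QuotientGroup.mk hbar : (ZMod (2 ^ a))ˣ ⧸ Subgroup.zpowers ubar) =
      2 ^ max (min (padicValInt 2 (u - 1)) a - padicValInt 2 (h + 1)) 1 := by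
  obtain ⟨c, hc, hu1⟩ := exists_odd_eq_two_pow_padicValInt_mul
    (z := u - 1) (by rintro h0; simp [h0] at hvu)
  obtain ⟨d, hd, hh1⟩ := exists_odd_eq_two_pow_padicValInt_mul
    (z := h - 1) (by rintro h0; simp [h0] at hvh)
  obtain ⟨e, he, hh2⟩ := exists_odd_eq_two_pow_padicValInt_mul
    (z := h + 1) (by omega)
  rw [hvh, pow_one] at hh1
  set s := padicValInt 2 (u - 1)
  set k := padicValInt 2 (h + 1)
  have hk : 1 ≤ k := by
    by_contra! hk0
    rw [Nat.lt_one_iff.1 hk0, pow_zero, one_mul] at hh2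
    exact Int.not_even_iff_odd.2 he (hh2 ▸ hh.add_one)
  have hpow (n : ℕ) :
      (QuotientGroup.mk hbar : (ZMod (2 ^ a))ˣ ⧸ Subgroup.zpowers ubar) ^ n = 1 ↔
        (2 : ℤ) ^ min s a ∣ h ^ n - 1 := by
    rw [← QuotientGroup.mk_pow, QuotientGroup.eq_one_iff]
    exact mem_zpowers_units_zmod_two_pow_iff hvu hc hu1 hub (by push_cast; rw [hhb])
  have hsq : h ^ 2 - 1 = 2 ^ (k + 1) * (e * d) := by
    calc h ^ 2 - 1 = (h + 1) * (h - 1) := by ring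
      _ = 2 ^ (k + 1) * (e * d) := by rw [hh1, hh2]; ring
  have hdvd (j : ℕ) : (2 : ℤ) ^ min s a ∣ h ^ 2 ^ (j + 1) - 1 ↔ min s a ≤ k + 1 + j := by
    obtain ⟨f, hf, h'⟩ := exists_odd_pow_two_pow_sub_one (by omega) (he.mul hd) hsq j
    rw [pow_succ', pow_mul, h', two_pow_dvd_two_pow_mul_odd_iff hf]
  obtain ⟨v, hv⟩ : ∃ v, max (min s a - k) 1 = v + 1 := ⟨max (min s a - k) 1 - 1, by omega⟩
  rw [hv]
  refine orderOf_eq_prime_pow ?_ ?_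
  · rw [hpow]
    cases v with
    | zero =>
      have := two_pow_dvd_two_pow_mul_odd_iff (m := min s a) (n := 1) hd
      rw [pow_one] at this
      rw [pow_zero, pow_one, hh1, this]
      omega
    | succ v =>
      rw [hdvd]
      omega
  · rw [hpow, hdvd]
    omega
end

section
/- Let s be an integer with gcd(s, rn) = 1, s ≡ 1 (mod r), s ≠ 1 and s ≠ −1. For a positive integer m, there exists a Type I m-adic splitting of 1+rZ_{rn} given by μ_s if and only if, for every prime p, ν_p(m) ≤ ν_p(M_s), where ν_p(M_s) is defined as follows: if p does not divide r or p does not divide n, then ν_p(M_s) = 0; otherwise: (i) if p is odd, or p = 2 with both ν₂(q−1) ≥ 2 and ν₂(s−1) ≥ 2, then ν_p(M_s) = max{ min{ν_p(q−1), ν_p(rn)} − ν_p(s−1), 0 }; (ii) if p = 2, ν₂(q−1) = 1 and ν₂(s−1) ≥ 2, then ν₂(M_s) = max{ min{ν₂(q+1)+1, ν₂(rn)} − ν₂(s−1), 0 }; (iii) if p = 2, ν₂(q−1) ≥ 2 and ν₂(s−1) = 1, then ν₂(M_s) = max{ min{ν₂(q−1), ν₂(rn)} − ν₂(s+1), 1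 }; (iv) if p = 2, ν₂(q−1) = 1 and ν₂(s−1) = 1, then ν₂(M_s) = max{ min{ν₂(q+1)+1, ν₂(rn)} − min{ν₂(s+1), ν₂(q+1)}, 0 } when ν₂(s+1) ≠ ν₂(q+1), and ν₂(M_s) = 0 when ν₂(s+1) = ν₂(q+1). (Equivalently: μ_s gives a Type I m-adic splitting if and only if m divides M_s = ∏_p p^{ν_p(M_s)}.) -/
/-- The subset `1 + r·Z_{rn}` of `Z_{rn} = ZMod (r*n)`, i.e. the residues
congruent to `1` modulo `r`. -/
def oneAddRZ (n r : ℕ) : Set (ZMod (r * n)) :=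
  {x | ∃ k : ZMod (r * n), x = 1 + (r : ZMod (r * n)) * k}

/-- `X` is a Type I `m`-adic splitting of `1 + r·Z_{rn}` given by the multiplier
`μ_s`: a partition of `1 + r·Z_{rn}` into `m` pairwise disjoint subsets, indexed
cyclically by `ZMod m`, each invariant under `μ_q : x ↦ qx`, and with
`μ_s : x ↦ sx` carrying `X j` onto `X (j+1)` (subscripts modulo `m`). -/
def IsTypeISplitting (q n r : ℕ) (s : ℤ) (m : ℕ)
    (X : ZMod m → Set (ZMod (r * n))) : Prop :=
  Pairwise (Function.onFun Disjoint X) ∧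
  (⋃ j, X j) = oneAddRZ n r ∧
  (∀ j, (fun x => (q : ZMod (r * n)) * x) '' X j = X j) ∧
  (∀ j, (fun x => (s : ZMod (r * n)) * x) '' X j = X (j + 1))

/-- Lifting the exponent for `a ^ i - 1`, including `p = 2` when `a ≡ 1 (mod 4)`. -/
theorem emultiplicity_pow_sub_one {p : ℕ} (hp : p.Prime) {a : ℤ} (ha : (p : ℤ) ∣ a - 1)
    (ha4 : p = 2 → (4 : ℤ) ∣ a - 1) (i : ℕ) :
    emultiplicity (p : ℤ) (a ^ i - 1) = emultiplicity (p : ℤ) (a - 1) + emultiplicity p i := by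
  have hpa : ¬(p : ℤ) ∣ a := fun h =>
    (Nat.prime_iff_prime_int.mp hp).not_dvd_one (by simpa using dvd_sub h ha)
  rcases hp.eq_two_or_odd' with rfl | hodd
  · have h := Int.two_pow_sub_pow' i (ha4 rfl) hpa
    rw [one_pow] at h
    rw [← Int.natCast_emultiplicity 2 i]
    exact h
  · simpa using Int.emultiplicity_pow_sub_pow hp hodd ha hpa i

theorem pow_dvd_pow_sub_one_iff {p : ℕ} (hp : p.Prime) {a : ℤ} (ha1 : a ≠ 1)
    (ha : (p : ℤ) ∣ a - 1) (ha4 : p = 2 → (4 : ℤ) ∣ a - 1) (k i : ℕ) :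
    (p : ℤ) ^ k ∣ a ^ i - 1 ↔ p ^ (k - padicValInt p (a - 1)) ∣ i := by
  have hfin : FiniteMultiplicity (p : ℤ) (a - 1) :=
    Int.finiteMultiplicity_iff.mpr ⟨by simpa using hp.ne_one, sub_ne_zero.mpr ha1⟩
  rw [pow_dvd_iff_le_emultiplicity, pow_dvd_iff_le_emultiplicity,
    emultiplicity_pow_sub_one hp ha ha4, hfin.emultiplicity_eq_multiplicity,
    padicValInt.of_ne_one_ne_zero hp.ne_one (sub_ne_zero.mpr ha1), ENat.natCast_sub,
    tsub_le_iff_left]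

theorem exists_modEq_pow_of_dvd {p : ℕ} (hp : p.Prime) {a : ℤ} (ha1 : a ≠ 1)
    (ha : (p : ℤ) ∣ a - 1) (ha4 : p = 2 → (4 : ℤ) ∣ a - 1) {b : ℤ} (e : ℕ)
    (hb : (p : ℤ) ^ min (padicValInt p (a - 1)) e ∣ b - 1) :
    ∃ j : ℕ, b ≡ a ^ j [ZMOD (p : ℤ) ^ e] := by
  have := Fact.mk hp
  have hpi : Prime (p : ℤ) := Nat.prime_iff_prime_int.mp hp
  set v := padicValInt p (a - 1) with hv
  have hv1 : 1 ≤ v := by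
    have := (padicValInt_dvd_iff (p := p) 1 (a - 1)).mp (by simpa using ha)
    exact this.resolve_left (sub_ne_zero.mpr ha1)
  induction e with
  | zero => exact ⟨0, by simp [Int.modEq_one]⟩
  | succ e ih =>
    rcases Nat.lt_or_ge e v with hev | hev
    · refine ⟨0, ?_⟩
      rw [min_eq_right hev] at hb
      exact (Int.modEq_iff_dvd.mpr (by simpa using hb)).symm
    · obtain ⟨j, hj⟩ := ih ((pow_dvd_pow _ (by omega)).trans hb)
      obtain ⟨c, hc⟩ := Int.modEq_iff_dvd.mp hj.symm
      obtain ⟨u, hu⟩ := (pow_dvd_pow_sub_one_iff hp ha1 ha ha4 e (p ^ (e - v))).mpr dvd_rfl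
      have hpu : ¬(p : ℤ) ∣ u := by
        rintro ⟨w, rfl⟩
        have h : (p : ℤ) ^ (e + 1) ∣ a ^ p ^ (e - v) - 1 := ⟨w, by rw [hu]; ring⟩
        rw [pow_dvd_pow_sub_one_iff hp ha1 ha ha4, Nat.pow_dvd_pow_iff_le_right hp.one_lt] at h
        omega
      have hpa : ¬(p : ℤ) ∣ a := fun h => hpi.not_dvd_one (by simpa using dvd_sub h ha)
      have hne : ((a ^ j * u : ℤ) : ZMod p) ≠ 0 := by
        rw [Ne, ZMod.intCast_zmod_eq_zero_iff_dvd]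
        exact fun h => (hpi.dvd_or_dvd h).elim (fun h => hpa (hpi.dvd_of_dvd_pow h)) hpu
      set k : ℕ := ((c : ZMod p) / ((a ^ j * u : ℤ) : ZMod p)).val with hk
      have hkc : (p : ℤ) ∣ a ^ j * u * k - c := by
        rw [← ZMod.intCast_zmod_eq_zero_iff_dvd, Int.cast_sub, Int.cast_mul, Int.cast_natCast, hk,
          ZMod.natCast_zmod_val, mul_div_cancel₀ _ hne, sub_self]
      refine ⟨j + p ^ (e - v) * k, Int.modEq_iff_dvd.mpr ?_⟩
      obtain ⟨d, hd⟩ := sq_dvd_add_pow_sub_sub ((p : ℤ) ^ e * u) 1 k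
      obtain ⟨w, hw⟩ := hkc
      have hpe : (p : ℤ) ^ (e + 1) ∣ (p ^ e) ^ 2 := by
        rw [← pow_mul]
        exact pow_dvd_pow _ (by omega)
      have hexp : a ^ (j + p ^ (e - v) * k) - b =
          p ^ (e + 1) * w + (p ^ e) ^ 2 * (a ^ j * u ^ 2 * d) := by
        have h1 : a ^ p ^ (e - v) = 1 + p ^ e * u := by linarith
        rw [pow_add, pow_mul, h1]
        simp only [one_pow, one_mul] at hd
        linear_combination a ^ j * hd - hc + p ^ e * hw
      rw [hexp]
      exact dvd_add (dvd_mul_right _ _) (hpe.mul_right _)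

theorem exists_modEq_pow_iff {p : ℕ} (hp : p.Prime) {a b : ℤ} (ha1 : a ≠ 1) (hb1 : b ≠ 1)
    (ha : (p : ℤ) ∣ a - 1) (ha4 : p = 2 → (4 : ℤ) ∣ a - 1)
    (hb : (p : ℤ) ∣ b - 1) (hb4 : p = 2 → (4 : ℤ) ∣ b - 1) (e i : ℕ) :
    (∃ j : ℕ, b ^ i ≡ a ^ j [ZMOD (p : ℤ) ^ e]) ↔
      p ^ (min (padicValInt p (a - 1)) e - padicValInt p (b - 1)) ∣ i := by
  have := Fact.mk hp
  rw [← pow_dvd_pow_sub_one_iff hp hb1 hb hb4]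
  refine ⟨?_, exists_modEq_pow_of_dvd hp ha1 ha ha4 e⟩
  rintro ⟨j, hj⟩
  have h1 : (p : ℤ) ^ min (padicValInt p (a - 1)) e ∣ b ^ i - a ^ j :=
    (pow_dvd_pow _ (min_le_right _ _)).trans (Int.modEq_iff_dvd.mp hj.symm)
  have h2 : (p : ℤ) ^ min (padicValInt p (a - 1)) e ∣ a ^ j - 1 :=
    ((pow_dvd_pow _ (min_le_left _ _)).trans (padicValInt_dvd _)).trans (sub_one_dvd_pow_sub_one a j)
  simpa using dvd_add h1 h2

theorem pow_dvd_pow_sub_one_of_dvd {p : ℕ} {a : ℤ} (ha : (p : ℤ) ∣ a - 1) {e k : ℕ}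
    (hk : p ^ e ∣ k) : (p : ℤ) ^ e ∣ a ^ k - 1 := by
  obtain ⟨c, rfl⟩ := hk
  have h : (p : ℤ) ^ e ∣ a ^ p ^ e - 1 := by
    simpa using (pow_dvd_pow _ e.le_succ).trans (dvd_sub_pow_of_dvd_sub ha e)
  rw [pow_mul]
  exact h.trans (sub_one_dvd_pow_sub_one _ _)

theorem four_dvd_sub_one_iff {a : ℤ} (ha1 : a ≠ 1) :
    (4 : ℤ) ∣ a - 1 ↔ 2 ≤ padicValInt 2 (a - 1) := by
  have h := padicValInt_dvd_iff (p := 2) 2 (a - 1)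
  norm_num at h
  rw [h, or_iff_right (sub_ne_zero.mpr ha1)]

theorem padicValInt_two_sub_one_eq_one_iff {a : ℤ} (ha1 : a ≠ 1) :
    padicValInt 2 (a - 1) = 1 ↔ (4 : ℤ) ∣ a + 1 := by
  have h1 := padicValInt_dvd_iff (p := 2) 1 (a - 1)
  have h2 := four_dvd_sub_one_iff ha1
  rw [or_iff_right (sub_ne_zero.mpr ha1)] at h1
  norm_num at h1
  omega

theorem padicValInt_two_sq_sub_one {a : ℤ} (ha1 : a ≠ 1) (ha1' : a ≠ -1) (ha : (4 : ℤ) ∣ a + 1) :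
    padicValInt 2 (a ^ 2 - 1) = padicValInt 2 (a + 1) + 1 := by
  have h : a + 1 ≠ 0 := fun h => ha1' (by linarith)
  rw [show a ^ 2 - 1 = (a + 1) * (a - 1) by ring, padicValInt.mul h (sub_ne_zero.mpr ha1),
    (padicValInt_two_sub_one_eq_one_iff ha1).mpr ha]

theorem four_dvd_sq_sub_one {a : ℤ} (ha : (4 : ℤ) ∣ a + 1) : (4 : ℤ) ∣ a ^ 2 - 1 := by
  rw [show a ^ 2 - 1 = (a + 1) * (a - 1) by ring]
  exact ha.mul_right _

theorem even_of_four_dvd_pow_sub_one {a : ℤ} (ha : (4 : ℤ) ∣ a + 1) {j : ℕ}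
    (hj : (4 : ℤ) ∣ a ^ j - 1) : Even j := by
  have h : a ≡ -1 [ZMOD 4] := (Int.modEq_iff_dvd.mpr (by simpa using ha)).symm
  by_contra hodd
  have h2 : (1 : ℤ) ≡ -1 [ZMOD 4] := by
    have := (h.pow j).trans (by rw [(Nat.not_even_iff_odd.mp hodd).neg_one_pow])
    exact (Int.modEq_iff_dvd.mpr hj).trans this
  revert h2
  decide

theorem modEq_four_of_modEq_two_pow {x y : ℤ} {e : ℕ} (he : 2 ≤ e) (h : x ≡ y [ZMOD (2 : ℤ) ^ e]) :
    x ≡ y [ZMOD 4] :=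
  h.of_dvd (by simpa using pow_dvd_pow (2 : ℤ) he)

theorem exists_modEq_pow_iff_of_neg_one_of_one {a b : ℤ} (ha1 : a ≠ 1) (ha1' : a ≠ -1)
    (hb1 : b ≠ 1) (ha : (4 : ℤ) ∣ a + 1) (hb : (4 : ℤ) ∣ b - 1) {e : ℕ} (he : 2 ≤ e) (i : ℕ) :
    (∃ j : ℕ, b ^ i ≡ a ^ j [ZMOD (2 : ℤ) ^ e]) ↔
      2 ^ (min (padicValInt 2 (a + 1) + 1) e - padicValInt 2 (b - 1)) ∣ i := by
  have ha4 := four_dvd_sq_sub_one ha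
  have hsq : a ^ 2 ≠ 1 := by
    rw [Ne, sq_eq_one_iff]
    tauto
  have key := exists_modEq_pow_iff Nat.prime_two hsq hb1 (by push_cast; omega) (fun _ => ha4)
    (by push_cast; omega) (fun _ => hb) e i
  rw [padicValInt_two_sq_sub_one ha1 ha1' ha] at key
  rw [← key]
  constructor
  · rintro ⟨j, hj⟩
    have h4 : (4 : ℤ) ∣ a ^ j - 1 := by
      have h1 := Int.modEq_iff_dvd.mp (modEq_four_of_modEq_two_pow he hj)
      have h2 := hb.trans (sub_one_dvd_pow_sub_one b i)
      simpa using dvd_add h1 h2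
    obtain ⟨k, rfl⟩ := (even_of_four_dvd_pow_sub_one ha h4).two_dvd
    exact ⟨k, by rw [← pow_mul]; exact hj⟩
  · rintro ⟨j, hj⟩
    exact ⟨2 * j, by rw [pow_mul]; exact hj⟩

theorem exists_modEq_pow_iff_of_one_of_neg_one {a b : ℤ} (ha1 : a ≠ 1) (hb1 : b ≠ 1)
    (hb1' : b ≠ -1) (ha : (4 : ℤ) ∣ a - 1) (hb : (4 : ℤ) ∣ b + 1) {e : ℕ} (he : 2 ≤ e) (i : ℕ) :
    (∃ j : ℕ, b ^ i ≡ a ^ j [ZMOD (2 : ℤ) ^ e]) ↔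
      2 ^ max (min (padicValInt 2 (a - 1)) e - padicValInt 2 (b + 1)) 1 ∣ i := by
  have hb4 := four_dvd_sq_sub_one hb
  have hsq : b ^ 2 ≠ 1 := by
    rw [Ne, sq_eq_one_iff]
    tauto
  have key := exists_modEq_pow_iff Nat.prime_two ha1 hsq (by push_cast; omega) (fun _ => ha)
    (by push_cast; omega) (fun _ => hb4) e
  rw [padicValInt_two_sq_sub_one hb1 hb1' hb] at key
  rw [show max (min (padicValInt 2 (a - 1)) e - padicValInt 2 (b + 1)) 1 =
    1 + (min (padicValInt 2 (a - 1)) e - (padicValInt 2 (b + 1) + 1)) by omega]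
  have heven : (∃ j : ℕ, b ^ i ≡ a ^ j [ZMOD (2 : ℤ) ^ e]) → 2 ∣ i := by
    rintro ⟨j, hj⟩
    refine (even_of_four_dvd_pow_sub_one hb ?_).two_dvd
    have h1 := Int.modEq_iff_dvd.mp (modEq_four_of_modEq_two_pow he hj).symm
    have h2 := ha.trans (sub_one_dvd_pow_sub_one a j)
    simpa using dvd_add h1 h2
  by_cases h2 : 2 ∣ i
  · obtain ⟨k, rfl⟩ := h2
    rw [pow_add, pow_one, Nat.mul_dvd_mul_iff_left two_pos, ← key]
    simp only [pow_mul, Nat.cast_ofNat]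
  · exact iff_of_false (fun h => h2 (heven h)) fun h => h2 ((Dvd.intro _ (pow_add 2 1 _).symm).trans h)

theorem exists_modEq_pow_iff_mul {p : ℕ} {a b : ℤ} (ha : (p : ℤ) ∣ a - 1) (e i : ℕ) :
    (∃ j : ℕ, b ^ i ≡ a ^ j [ZMOD (p : ℤ) ^ e]) ↔
      ∃ j : ℕ, (b * a) ^ i ≡ a ^ j [ZMOD (p : ℤ) ^ e] := by
  constructor
  · rintro ⟨j, hj⟩
    exact ⟨j + i, by rw [mul_pow, pow_add]; exact hj.mul_right _⟩
  · rintro ⟨j, hj⟩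
    have hone : a ^ p ^ e ≡ 1 [ZMOD (p : ℤ) ^ e] := by
      exact (Int.modEq_iff_dvd.mpr (pow_dvd_pow_sub_one_of_dvd ha dvd_rfl)).symm
    rcases (p ^ e).eq_zero_or_pos with h0 | hpos
    · have h0' : (p : ℤ) ^ e = 0 := by exact_mod_cast h0
      have hp0 : p = 0 := by
        by_contra hp
        exact pow_ne_zero e hp h0
      subst hp0
      obtain rfl : a = 1 := by simpa [sub_eq_zero] using ha
      exact ⟨0, by simpa using hj⟩
    · obtain ⟨c, hc⟩ : ∃ c, p ^ e = c + 1 := ⟨p ^ e - 1, by omega⟩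
      refine ⟨j + c * i, ?_⟩
      calc b ^ i = b ^ i * 1 ^ i := by simp
        _ ≡ b ^ i * (a ^ p ^ e) ^ i [ZMOD (p : ℤ) ^ e] := (hone.symm.pow i).mul_left _
        _ = (b * a) ^ i * a ^ (c * i) := by rw [hc]; ring
        _ ≡ a ^ j * a ^ (c * i) [ZMOD (p : ℤ) ^ e] := hj.mul_right _
        _ = a ^ (j + c * i) := (pow_add _ _ _).symm

theorem padicValInt_two_mul_sub_one {a b : ℤ} (ha1 : a ≠ -1) (hb1 : b ≠ -1) (hab : b * a ≠ 1)
    (ha : (4 : ℤ) ∣ a + 1) :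
    (padicValInt 2 (b + 1) = padicValInt 2 (a + 1) →
        padicValInt 2 (a + 1) + 1 ≤ padicValInt 2 (b * a - 1)) ∧
      (padicValInt 2 (b + 1) ≠ padicValInt 2 (a + 1) →
        padicValInt 2 (b * a - 1) = min (padicValInt 2 (b + 1)) (padicValInt 2 (a + 1))) := by
  have ha0 : a + 1 ≠ 0 := fun h => ha1 (by linarith)
  have hb0 : b + 1 ≠ 0 := fun h => hb1 (by linarith)
  have hab0 := sub_ne_zero.mpr hab
  have h2 : ∀ {c : ℤ}, c ≠ 0 → ∀ n, (2 : ℤ) ^ n ∣ c ↔ n ≤ padicValInt 2 c := fun {c} hc n =>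
    (padicValInt_dvd_iff (p := 2) n c).trans (or_iff_right hc)
  obtain ⟨u, hu⟩ := (h2 ha0 _).mpr le_rfl
  obtain ⟨v, hv⟩ := (h2 hb0 _).mpr le_rfl
  have odd_of : ∀ {c w : ℤ}, c ≠ 0 → c = 2 ^ padicValInt 2 c * w → ¬(2 : ℤ) ∣ w := by
    rintro c w hc h ⟨z, rfl⟩
    have := (h2 hc (padicValInt 2 c + 1)).mp ⟨z, by rw [pow_succ, mul_assoc]; exact h⟩
    omega
  have hu2 := odd_of ha0 hu
  have hv2 := odd_of hb0 hv
  have hodd : ¬(2 : ℤ) ∣ a := by omega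
  have hexp : b * a - 1 = (b + 1) * a - (a + 1) := by ring
  set x := padicValInt 2 (a + 1)
  set y := padicValInt 2 (b + 1)
  have hprod : ¬(2 : ℤ) ∣ v * a := fun h =>
    (Int.prime_two.dvd_or_dvd h).elim hv2 hodd
  have val : ∀ k w, b * a - 1 = 2 ^ k * w → ¬(2 : ℤ) ∣ w → padicValInt 2 (b * a - 1) = k := by
    intro k w h hw
    refine le_antisymm ?_ ((h2 hab0 k).mp ⟨w, h⟩)
    by_contra hlt
    obtain ⟨z, hz⟩ := (h2 hab0 (k + 1)).mpr (by omega)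
    refine hw ⟨z, mul_left_cancel₀ (pow_ne_zero k two_ne_zero) (h.symm.trans (hz.trans ?_))⟩
    ring
  refine ⟨fun hxy => ?_, fun hxy => ?_⟩
  · rw [← h2 hab0]
    obtain ⟨z, hz⟩ : (2 : ℤ) ∣ v * a - u := by omega
    refine ⟨z, ?_⟩
    rw [hexp, hu, hv, hxy]
    linear_combination 2 ^ x * hz
  · rcases lt_or_gt_of_ne hxy with h | h
    · obtain ⟨d, hd⟩ : ∃ d, x = y + (d + 1) := ⟨x - y - 1, by omega⟩
      rw [min_eq_left h.le]
      refine val y (v * a - 2 * (2 ^ d * u)) ?_ (by omega)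
      rw [hexp, hu, hv, hd]
      ring
    · obtain ⟨d, hd⟩ : ∃ d, y = x + (d + 1) := ⟨y - x - 1, by omega⟩
      rw [min_eq_right h.le]
      refine val x (2 * (2 ^ d * (v * a)) - u) ?_ (by omega)
      rw [hexp, hu, hv, hd]
      ring

/-- The `p`-adic valuation of the order of `s` modulo the powers of `q`, at a prime `p` dividing
`q - 1` and `s - 1`, in `ZMod N`. -/
def multiplierExponent (q N : ℕ) (s : ℤ) (p : ℕ) : ℕ :=
  if p ≠ 2 ∨ (2 ≤ (q - 1).factorization 2 ∧ 2 ≤ padicValInt 2 (s - 1)) then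
    max (min ((q - 1).factorization p) (N.factorization p) - padicValInt p (s - 1)) 0
  else if (q - 1).factorization 2 = 1 ∧ 2 ≤ padicValInt 2 (s - 1) then
    max (min ((q + 1).factorization 2 + 1) (N.factorization 2) - padicValInt 2 (s - 1)) 0
  else if 2 ≤ (q - 1).factorization 2 ∧ padicValInt 2 (s - 1) = 1 then
    max (min ((q - 1).factorization 2) (N.factorization 2) - padicValInt 2 (s + 1)) 1
  else
    if padicValInt 2 (s + 1) = (q + 1).factorization 2 then 0
    else
      max (min ((q + 1).factorization 2 + 1) (N.factorization 2)
        - min (padicValInt 2 (s + 1)) ((q + 1).factorization 2)) 0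

theorem exists_modEq_pow_iff_multiplierExponent {q N p : ℕ} {s : ℤ} (hp : p.Prime) (hq : 2 ≤ q)
    (hs1 : s ≠ 1) (hs1' : s ≠ -1) (hpq : p ∣ q - 1) (hps : (p : ℤ) ∣ s - 1)
    (hN : 2 ≤ N.factorization p) (i : ℕ) :
    (∃ j : ℕ, s ^ i ≡ (q : ℤ) ^ j [ZMOD (p : ℤ) ^ N.factorization p]) ↔
      p ^ multiplierExponent q N s p ∣ i := by
  have := Fact.mk hp
  have hq1 : (q : ℤ) ≠ 1 := by omega
  have hq1' : (q : ℤ) ≠ -1 := by omega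
  have hpq' : (p : ℤ) ∣ q - 1 := by
    rw [← Int.natCast_dvd_natCast] at hpq
    rwa [Nat.cast_sub (by omega), Nat.cast_one] at hpq
  have hsub : ∀ l : ℕ, l.Prime → (q - 1).factorization l = padicValInt l ((q : ℤ) - 1) := by
    intro l hl
    rw [Nat.factorization_def _ hl, ← padicValInt.of_nat, Nat.cast_sub (by omega), Nat.cast_one]
  have hadd : (q + 1).factorization 2 = padicValInt 2 ((q : ℤ) + 1) := by
    rw [Nat.factorization_def _ Nat.prime_two, ← padicValInt.of_nat, Nat.cast_add, Nat.cast_one]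
  unfold multiplierExponent
  rw [hsub p hp, hsub 2 Nat.prime_two, hadd]
  by_cases hp2 : p = 2
  swap
  · rw [if_pos (Or.inl hp2), Nat.max_zero]
    exact exists_modEq_pow_iff hp hq1 hs1 hpq' (fun h => absurd h hp2) hps (fun h => absurd h hp2) _ i
  subst hp2
  generalize N.factorization 2 = e at *
  have hval : ∀ {c : ℤ}, c ≠ 1 → ((2 : ℕ) : ℤ) ∣ c - 1 → 1 ≤ padicValInt 2 (c - 1) := fun hc h =>
    ((padicValInt_dvd_iff (p := 2) 1 _).mp (by simpa using h)).resolve_left (sub_ne_zero.mpr hc)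
  have hvq := hval hq1 hpq'
  have hvs := hval hs1 hps
  rw [Nat.cast_ofNat]
  rcases Nat.lt_or_ge 1 (padicValInt 2 ((q : ℤ) - 1)) with hq4 | hq4 <;>
    rcases Nat.lt_or_ge 1 (padicValInt 2 (s - 1)) with hs4 | hs4
  · rw [if_pos (Or.inr ⟨hq4, hs4⟩), Nat.max_zero]
    exact exists_modEq_pow_iff hp hq1 hs1 hpq' (fun _ => (four_dvd_sub_one_iff hq1).mpr hq4) hps
      (fun _ => (four_dvd_sub_one_iff hs1).mpr hs4) e i
  · rw [if_neg (by omega), if_neg (by omega), if_pos (by omega)]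
    exact exists_modEq_pow_iff_of_one_of_neg_one hq1 hs1 hs1' ((four_dvd_sub_one_iff hq1).mpr hq4)
      ((padicValInt_two_sub_one_eq_one_iff hs1).mp (by omega)) hN i
  · rw [if_neg (by omega), if_pos (by omega), Nat.max_zero]
    exact exists_modEq_pow_iff_of_neg_one_of_one hq1 hq1' hs1
      ((padicValInt_two_sub_one_eq_one_iff hq1).mp (by omega))
      ((four_dvd_sub_one_iff hs1).mpr hs4) hN i
  · rw [if_neg (by omega), if_neg (by omega), if_neg (by omega), Nat.max_zero]
    have hq3 := (padicValInt_two_sub_one_eq_one_iff hq1).mp (by omega)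
    have hs3 := (padicValInt_two_sub_one_eq_one_iff hs1).mp (by omega)
    have hsq1 : s * q ≠ 1 := fun h => by
      have := Int.isUnit_iff.mp (IsUnit.of_mul_eq_one_right _ h)
      omega
    have hsq4 : (4 : ℤ) ∣ s * q - 1 := by
      rw [show s * q - 1 = (s + 1) * q - (q + 1) by ring]
      exact dvd_sub (hs3.mul_right _) hq3
    obtain ⟨heq, hne⟩ := padicValInt_two_mul_sub_one hq1' hs1' hsq1 hq3
    have hmul := exists_modEq_pow_iff_mul (b := s) hpq' e i
    rw [Nat.cast_ofNat] at hmul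
    rw [hmul, exists_modEq_pow_iff_of_neg_one_of_one hq1 hq1' hsq1 hq3 hsq4 hN]
    split_ifs with h
    · rw [Nat.sub_eq_zero_of_le ((min_le_left _ _).trans (heq h))]
    · rw [hne h]

theorem exists_coloring_of_orbits {G α : Type*} [CommGroup G] [MulAction G α] (s q : G) (m : ℕ)
    (O : Set α)
    (h : ∀ x ∈ O, ∀ i j : ℤ, s ^ i • x = q ^ j • x → (m : ℤ) ∣ i) :
    ∃ f : α → ZMod m, ∀ x ∈ O,
      (s • x ∈ O → f (s • x) = f x + 1) ∧ (q • x ∈ O → f (q • x) = f x) := by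
  let H := Subgroup.closure {s, q}
  let rep : α → α := fun x => (Quotient.mk (MulAction.orbitRel H α) x).out
  have hrep : ∀ x, ∃ i j : ℤ, (s ^ i * q ^ j) • rep x = x := by
    intro x
    have h1 : (MulAction.orbitRel H α) (rep x) x := Quotient.exact (Quotient.out_eq _)
    obtain ⟨g, hg⟩ := (MulAction.orbitRel H α).symm h1
    obtain ⟨i, j, hij⟩ := Subgroup.mem_closure_pair.mp g.2
    exact ⟨i, j, by rw [hij]; exact hg⟩
  have hrep_eq : ∀ (g : G) (x : α), g ∈ H → rep (g • x) = rep x := by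
    intro g x hg
    have : (MulAction.orbitRel H α) (g • x) x := ⟨⟨g, hg⟩, rfl⟩
    exact congrArg Quotient.out (Quotient.sound this)
  choose e e' he using hrep
  have hs : s ∈ H := Subgroup.subset_closure (by simp)
  have hq : q ∈ H := Subgroup.subset_closure (by simp)
  have key : ∀ x ∈ O, ∀ a b : ℤ, (s ^ a * q ^ b) • rep x = x → ((e x : ℤ) : ZMod m) = a := by
    intro x hx a b hab
    rw [← sub_eq_zero, ← Int.cast_sub, ZMod.intCast_zmod_eq_zero_iff_dvd]
    refine h x hx _ (b - e' x) ?_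
    have h2 : (s ^ e x * q ^ e' x) • rep x = (s ^ a * q ^ b) • rep x := (he x).trans hab.symm
    have h3 : s ^ (e x - a) • rep x = q ^ (b - e' x) • rep x := by
      have := congrArg (fun y => (s ^ (-a) * q ^ (-e' x)) • y) h2
      simp only [smul_smul] at this
      rw [mul_mul_mul_comm _ _ (s ^ e x), mul_mul_mul_comm _ _ (s ^ a), ← zpow_add,
        ← zpow_add, ← zpow_add, ← zpow_add,
        neg_add_cancel, neg_add_cancel, zpow_zero, zpow_zero, mul_one, one_mul] at this
      rwa [neg_add_eq_sub, neg_add_eq_sub] at this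
    calc s ^ (e x - a) • x = s ^ (e x - a) • (s ^ a * q ^ b) • rep x := by rw [hab]
      _ = (s ^ a * q ^ b) • s ^ (e x - a) • rep x := smul_comm _ _ _
      _ = (s ^ a * q ^ b) • q ^ (b - e' x) • rep x := by rw [h3]
      _ = q ^ (b - e' x) • (s ^ a * q ^ b) • rep x := smul_comm _ _ _
      _ = q ^ (b - e' x) • x := by rw [hab]
  refine ⟨fun x => (e x : ZMod m), fun x hx => ⟨fun hsx => ?_, fun hqx => ?_⟩⟩
  · have := key (s • x) hsx (e x + 1) (e' x) (by
      rw [hrep_eq s x hs, zpow_add_one, mul_right_comm, mul_comm, ← smul_smul, he])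
    simpa using this
  · exact key (q • x) hqx (e x) (e' x + 1) (by
      rw [hrep_eq q x hq, zpow_add_one, ← mul_assoc, mul_comm, ← smul_smul, he])

theorem mem_oneAddRZ_iff {n r : ℕ} {x : ZMod (r * n)} :
    x ∈ oneAddRZ n r ↔ ∃ a : ℤ, (r : ℤ) ∣ a - 1 ∧ (a : ZMod (r * n)) = x := by
  constructor
  · rintro ⟨k, rfl⟩
    obtain ⟨k, rfl⟩ := ZMod.intCast_surjective k
    exact ⟨1 + r * k, by simp, by simp⟩
  · rintro ⟨a, ⟨k, hk⟩, rfl⟩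
    exact ⟨k, by rw [← sub_eq_iff_eq_add']; exact_mod_cast congrArg Int.cast hk⟩

theorem mem_oneAddRZ_iff_castHom {n r : ℕ} {x : ZMod (r * n)} :
    x ∈ oneAddRZ n r ↔ ZMod.castHom (dvd_mul_right r n) (ZMod r) x = 1 := by
  obtain ⟨a, rfl⟩ := ZMod.intCast_surjective x
  rw [map_intCast, ← sub_eq_zero, ← Int.cast_one, ← Int.cast_sub,
    ZMod.intCast_zmod_eq_zero_iff_dvd, mem_oneAddRZ_iff]
  refine ⟨?_, fun h => ⟨a, h, rfl⟩⟩
  rintro ⟨b, hb, hab⟩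
  rw [← sub_eq_zero, ← Int.cast_sub, ZMod.intCast_zmod_eq_zero_iff_dvd] at hab
  have h := ((Int.natCast_dvd_natCast.mpr (dvd_mul_right r n)).trans hab)
  simpa using dvd_sub hb h

theorem units_smul_mem_oneAddRZ {n r : ℕ} {u : (ZMod (r * n))ˣ}
    (hu : (u : ZMod (r * n)) ∈ oneAddRZ n r) {x : ZMod (r * n)} :
    u • x ∈ oneAddRZ n r ↔ x ∈ oneAddRZ n r := by
  rw [mem_oneAddRZ_iff_castHom] at hu
  rw [mem_oneAddRZ_iff_castHom, mem_oneAddRZ_iff_castHom, Units.smul_def, smul_eq_mul, map_mul,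
    hu, one_mul]

theorem exists_isTypeISplitting_iff {q n r : ℕ} {s : ℤ} {m : ℕ} (hrn : r * n ≠ 0)
    (hq : IsUnit (q : ZMod (r * n))) (hs : IsUnit (s : ZMod (r * n)))
    (hqO : (q : ZMod (r * n)) ∈ oneAddRZ n r) (hsO : (s : ZMod (r * n)) ∈ oneAddRZ n r) :
    (∃ X : ZMod m → Set (ZMod (r * n)), IsTypeISplitting q n r s m X) ↔
      ∀ x ∈ oneAddRZ n r, ∀ i j : ℕ,
        (s : ZMod (r * n)) ^ i * x = (q : ZMod (r * n)) ^ j * x → m ∣ i := by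
  constructor
  · rintro ⟨X, hdisj, hunion, hXq, hXs⟩ x hx i j hij
    obtain ⟨c, hc⟩ := Set.mem_iUnion.mp (hunion ▸ hx)
    have h1 : ∀ i : ℕ, (s : ZMod (r * n)) ^ i * x ∈ X (c + i) := by
      intro i
      induction i with
      | zero => simpa using hc
      | succ i ih =>
        rw [Nat.cast_succ, ← add_assoc, ← hXs]
        exact ⟨_, ih, by ring⟩
    have h2 : ∀ j : ℕ, (q : ZMod (r * n)) ^ j * x ∈ X c := by
      intro j
      induction j with
      | zero => simpa using hc
      | succ j ih =>
        rw [← hXq]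
        exact ⟨_, ih, by ring⟩
    have heq : c + i = c := by
      by_contra hne
      exact Set.disjoint_left.mp (hdisj hne) (h1 i) (hij ▸ h2 j)
    rwa [add_eq_left, ZMod.natCast_eq_zero_iff] at heq
  · intro h
    have := NeZero.mk hrn
    obtain ⟨Q, hQ⟩ := hq
    obtain ⟨S, hS⟩ := hs
    rw [← hQ] at hqO
    rw [← hS] at hsO
    obtain ⟨f, hf⟩ := exists_coloring_of_orbits S Q m (oneAddRZ n r) (by
      intro x hx i j hij
      set c := Nat.card (ZMod (r * n))ˣ with hc
      have hcpos : 0 < c := Nat.card_pos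
      have hmc : m ∣ c := h x hx c 0 (by
        rw [← hS, ← Units.val_pow_eq_pow_val, pow_card_eq_one']
        simp)
      have hi := Int.emod_nonneg i (Nat.cast_ne_zero.mpr hcpos.ne' : (c : ℤ) ≠ 0)
      have hj := Int.emod_nonneg j (Nat.cast_ne_zero.mpr hcpos.ne' : (c : ℤ) ≠ 0)
      rw [← zpow_mod_natCard S, ← zpow_mod_natCard Q, ← hc, ← Int.toNat_of_nonneg hi,
        ← Int.toNat_of_nonneg hj, zpow_natCast, zpow_natCast] at hij
      have hmi := h x hx (i % c).toNat (j % c).toNat (by rw [← hS, ← hQ]; exact hij)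
      rw [← Int.natCast_dvd_natCast, Int.toNat_of_nonneg hi] at hmi
      exact (EuclideanDomain.dvd_mod_iff (Int.natCast_dvd_natCast.mpr hmc)).mp hmi)
    refine ⟨fun j => {x | x ∈ oneAddRZ n r ∧ f x = j}, ?_, ?_, ?_, ?_⟩
    · intro j k hjk
      exact Set.disjoint_left.mpr fun x hx hx' => hjk (hx.2.symm.trans hx'.2)
    · ext x
      simp
    · intro j
      ext y
      rw [← hQ]
      constructor
      · rintro ⟨x, ⟨hx, rfl⟩, rfl⟩
        have hQx := (units_smul_mem_oneAddRZ hqO).mpr hx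
        exact ⟨hQx, (hf x hx).2 hQx⟩
      · rintro ⟨hy, rfl⟩
        have hy' : Q • Q⁻¹ • y ∈ oneAddRZ n r := by rwa [smul_inv_smul]
        have hx := (units_smul_mem_oneAddRZ hqO).mp hy'
        refine ⟨Q⁻¹ • y, ⟨hx, ?_⟩, smul_inv_smul Q y⟩
        have := (hf _ hx).2 hy'
        rwa [smul_inv_smul, eq_comm] at this
    · intro j
      ext y
      rw [← hS]
      constructor
      · rintro ⟨x, ⟨hx, rfl⟩, rfl⟩
        have hSx := (units_smul_mem_oneAddRZ hsO).mpr hx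
        exact ⟨hSx, (hf x hx).1 hSx⟩
      · rintro ⟨hy, hyj⟩
        have hy' : S • S⁻¹ • y ∈ oneAddRZ n r := by rwa [smul_inv_smul]
        have hx := (units_smul_mem_oneAddRZ hsO).mp hy'
        refine ⟨S⁻¹ • y, ⟨hx, ?_⟩, smul_inv_smul S y⟩
        have := (hf _ hx).1 hy'
        rw [smul_inv_smul, hyj] at this
        exact (add_right_cancel this).symm

theorem natCast_dvd_of_prime_pow_dvd {N : ℕ} (hN : N ≠ 0) {z : ℤ}
    (h : ∀ l : ℕ, l.Prime → (l : ℤ) ^ N.factorization l ∣ z) : (N : ℤ) ∣ z := by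
  rw [Int.natCast_dvd, Nat.dvd_iff_prime_pow_dvd_dvd]
  intro l k hl hk
  rw [← Int.natCast_dvd, Nat.cast_pow]
  exact (pow_dvd_pow _ ((hl.pow_dvd_iff_le_factorization hN).mp hk)).trans (h l hl)

theorem exists_int_dvd_sub_one_and_prime_pow_dvd (N : ℕ) {r : ℕ} (hr : 0 < r) :
    ∃ a : ℤ, (r : ℤ) ∣ a - 1 ∧
      ∀ l : ℕ, l.Prime → ¬l ∣ r → (l : ℤ) ^ N.factorization l ∣ a := by
  set c := ∏ l ∈ N.primeFactors with ¬l ∣ r, l ^ N.factorization l with hc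
  have hcop : c.Coprime r := by
    refine Nat.Coprime.prod_left fun l hl => ?_
    rw [Finset.mem_filter, Nat.mem_primeFactors] at hl
    exact Nat.Coprime.pow_left _ ((Nat.Prime.coprime_iff_not_dvd hl.1.1).mpr hl.2)
  refine ⟨(c ^ r.totient : ℕ), ?_, fun l hl hlr => ?_⟩
  · have h := (Nat.modEq_iff_dvd.mp (Nat.ModEq.pow_totient hcop).symm)
    simpa using h
  · rw [← Nat.cast_pow, Int.natCast_dvd_natCast]
    refine Dvd.dvd.trans ?_ (dvd_pow_self c (Nat.totient_pos.mpr hr).ne')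
    by_cases hlN : l ∈ N.primeFactors
    · exact Finset.dvd_prod_of_mem (fun l => l ^ N.factorization l) (by simp [hlN, hlr])
    · rw [← Nat.support_factorization, Finsupp.notMem_support_iff] at hlN
      simp [hlN]

/-- Theorem 2 of the paper.  Let `s` be an integer with
`gcd(s, rn) = 1`, `s ≡ 1 (mod r)`, `s ≠ 1`, `s ≠ -1`.  A Type I `m`-adic
splitting of `1 + r·Z_{rn}` given by `μ_s` exists iff for every prime `p` we
have `ν_p(m) ≤ ν_p(M_s)`, where `ν_p(M_s)` is given by the explicit case
formula below. -/
theorem typeI_madic_multiplier_iff (q n r : ℕ) (hq : IsPrimePow q)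
    (hn : 0 < n) (hqn : Nat.gcd q n = 1) (hr : 0 < r) (hrdvd : r ∣ q - 1)
    (s : ℤ) (hs : Int.gcd s (r * n) = 1) (hsr : (r : ℤ) ∣ s - 1)
    (hs1 : s ≠ 1) (hsneg1 : s ≠ -1) (m : ℕ) (hm : 0 < m) :
    (∃ X : ZMod m → Set (ZMod (r * n)), IsTypeISplitting q n r s m X) ↔
      ∀ p : ℕ, p.Prime →
        m.factorization p ≤
          (if p ∣ r ∧ p ∣ n then
            (if p ≠ 2 ∨ (2 ≤ (q - 1).factorization 2 ∧ 2 ≤ padicValInt 2 (s - 1)) then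
              -- (i) `p` odd, or `p = 2` with `ν₂(q-1) ≥ 2` and `ν₂(s-1) ≥ 2`
              max (min ((q - 1).factorization p) ((r * n).factorization p)
                - padicValInt p (s - 1)) 0
            else if (q - 1).factorization 2 = 1 ∧ 2 ≤ padicValInt 2 (s - 1) then
              -- (ii) `p = 2`, `ν₂(q-1) = 1`, `ν₂(s-1) ≥ 2`
              max (min ((q + 1).factorization 2 + 1) ((r * n).factorization 2)
                - padicValInt 2 (s - 1)) 0
            else if 2 ≤ (q - 1).factorization 2 ∧ padicValInt 2 (s - 1) = 1 then
              -- (iii) `p = 2`, `ν₂(q-1) ≥ 2`, `ν₂(s-1) = 1`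
              max (min ((q - 1).factorization 2) ((r * n).factorization 2)
                - padicValInt 2 (s + 1)) 1
            else
              -- (iv) `p = 2`, `ν₂(q-1) = 1`, `ν₂(s-1) = 1`
              (if padicValInt 2 (s + 1) = (q + 1).factorization 2 then 0
               else
                max (min ((q + 1).factorization 2 + 1) ((r * n).factorization 2)
                  - min (padicValInt 2 (s + 1)) ((q + 1).factorization 2)) 0))
          else 0) := by
  have hq2 := hq.two_le
  have hrn : r * n ≠ 0 := (Nat.mul_pos hr hn).ne'
  have hqr : (r : ℤ) ∣ q - 1 := by
    have h := Int.natCast_dvd_natCast.mpr hrdvd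
    rwa [Nat.cast_sub (by omega), Nat.cast_one] at h
  have hqcop : q.Coprime (r * n) := by
    refine Nat.Coprime.mul_right ?_ hqn
    have h : (q - 1).Coprime q := by
      rw [Nat.coprime_self_sub_left (by omega)]
      exact Nat.coprime_one_left q
    exact (h.coprime_dvd_left hrdvd).symm
  have hqU : IsUnit (q : ZMod (r * n)) := (ZMod.isUnit_iff_coprime q (r * n)).mpr hqcop
  have hsU : IsUnit (s : ZMod (r * n)) := by
    rw [ZMod.coe_int_isUnit_iff_isCoprime, isCoprime_comm, Int.isCoprime_iff_gcd_eq_one]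
    exact_mod_cast hs
  rw [exists_isTypeISplitting_iff hrn hqU hsU (mem_oneAddRZ_iff.mpr ⟨q, hqr, by simp⟩)
    (mem_oneAddRZ_iff.mpr ⟨s, hsr, rfl⟩)]
  have hiff : ∀ (a : ℤ) (i j : ℕ), (s : ZMod (r * n)) ^ i * a = (q : ZMod (r * n)) ^ j * a ↔
      ((r * n : ℕ) : ℤ) ∣ (s ^ i - (q : ℤ) ^ j) * a := by
    intro a i j
    rw [← ZMod.intCast_zmod_eq_zero_iff_dvd, ← sub_eq_zero, ← sub_mul]
    push_cast
    rfl
  have hcop : ∀ {l : ℕ}, l.Prime → l ∣ r → ∀ {a : ℤ}, (r : ℤ) ∣ a - 1 → (l : ℤ) ∣ a - 1 :=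
    fun _ hlr _ ha => (Int.natCast_dvd_natCast.mpr hlr).trans ha
  have hlocal : ∀ {p : ℕ}, p.Prime → p ∣ r ∧ p ∣ n → ∀ i : ℕ,
      (∃ j : ℕ, s ^ i ≡ (q : ℤ) ^ j [ZMOD (p : ℤ) ^ (r * n).factorization p]) ↔
        p ^ multiplierExponent q (r * n) s p ∣ i := by
    intro p hp hprn
    refine exists_modEq_pow_iff_multiplierExponent hp hq2 hs1 hsneg1 (hprn.1.trans hrdvd)
      (hcop hp hprn.1 hsr) ?_
    rw [← hp.pow_dvd_iff_le_factorization hrn, sq]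
    exact mul_dvd_mul hprn.1 hprn.2
  change _ ↔ ∀ p : ℕ, p.Prime → m.factorization p ≤
    if p ∣ r ∧ p ∣ n then multiplierExponent q (r * n) s p else 0
  constructor
  · intro h p hp
    set F := if p ∣ r ∧ p ∣ n then multiplierExponent q (r * n) s p else 0 with hF
    obtain ⟨j, hj⟩ : ∃ j : ℕ, p ∣ r →
        s ^ p ^ F ≡ (q : ℤ) ^ j [ZMOD (p : ℤ) ^ (r * n).factorization p] := by
      by_cases hprn : p ∣ r ∧ p ∣ n
      · rw [hF, if_pos hprn]
        obtain ⟨j, hj⟩ := (hlocal hp hprn _).mpr dvd_rfl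
        exact ⟨j, fun _ => hj⟩
      · refine ⟨0, fun hpr => ?_⟩
        have hpn : ¬p ∣ n := fun hpn => hprn ⟨hpr, hpn⟩
        rw [hF, if_neg hprn, Nat.factorization_mul hr.ne' hn.ne', Finsupp.add_apply,
          Nat.factorization_eq_zero_of_not_dvd hpn, pow_zero, pow_zero, pow_one, add_zero]
        refine (Int.modEq_iff_dvd.mpr (Dvd.dvd.trans ?_ hsr)).symm
        exact_mod_cast Nat.ordProj_dvd r p
    set K := r * n / p ^ (r * n).factorization p with hK
    obtain ⟨a, har, ha⟩ := exists_int_dvd_sub_one_and_prime_pow_dvd (r * n) hr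
    have hdvd : ((r * n : ℕ) : ℤ) ∣ (s ^ (p ^ F * K) - (q : ℤ) ^ (j * K)) * a := by
      refine natCast_dvd_of_prime_pow_dvd hrn fun l hl => ?_
      by_cases hlr : l ∣ r
      swap
      · exact (ha l hl hlr).mul_left _
      refine Dvd.dvd.mul_right ?_ a
      by_cases hlp : l = p
      · subst hlp
        rw [pow_mul, pow_mul]
        exact Int.modEq_iff_dvd.mp ((hj hlr).pow K).symm
      · have hlK : l ^ (r * n).factorization l ∣ K := by
          refine (Nat.Coprime.pow _ _ ((Nat.coprime_primes hl hp).mpr hlp)).dvd_of_dvd_mul_left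
            (?_ : _ ∣ p ^ (r * n).factorization p * K)
          rw [hK, Nat.ordProj_mul_ordCompl_eq_self]
          exact Nat.ordProj_dvd _ _
        simpa using dvd_sub
          (pow_dvd_pow_sub_one_of_dvd (hcop hl hlr hsr) (hlK.mul_left (p ^ F)))
          (pow_dvd_pow_sub_one_of_dvd (hcop hl hlr hqr) (hlK.mul_left j))
    have hm' := h a (mem_oneAddRZ_iff.mpr ⟨a, har, rfl⟩) _ _ ((hiff _ _ _).mpr hdvd)
    have hpF : p ^ m.factorization p ∣ p ^ F :=
      (Nat.Coprime.pow_left _ (Nat.coprime_ordCompl hp hrn)).dvd_of_dvd_mul_right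
        ((Nat.ordProj_dvd m p).trans hm')
    exact (Nat.pow_dvd_pow_iff_le_right hp.one_lt).mp hpF
  · intro h x hx i j hij
    obtain ⟨a, har, rfl⟩ := mem_oneAddRZ_iff.mp hx
    rw [hiff] at hij
    rw [Nat.dvd_iff_prime_pow_dvd_dvd]
    intro p k hp hk
    have hk' := ((hp.pow_dvd_iff_le_factorization hm.ne').mp hk).trans (h p hp)
    split_ifs at hk' with hprn
    · refine (pow_dvd_pow _ hk').trans ((hlocal hp hprn i).mp ⟨j, ?_⟩)
      have hpa : IsCoprime ((p : ℤ) ^ (r * n).factorization p) a := by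
        obtain ⟨c, hc⟩ := hcop hp hprn.1 har
        exact IsCoprime.pow_left ⟨-c, 1, by linear_combination hc⟩
      refine (Int.modEq_iff_dvd.mpr (hpa.dvd_of_dvd_mul_right (Dvd.dvd.trans ?_ hij))).symm
      exact_mod_cast Nat.ordProj_dvd (r * n) p
    · simp [Nat.le_zero.mp hk']
end
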